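/- Let n > 2, and regard the permutations w_k^{(n−1,1)} as elements of S_n. Then in ℤ[x_1, …, x_n]: 𝔖_{s_{n−1}} · 𝔖_{w_1^{(n−1,1)}} = 𝔖_{w_1^{(n−1,1)} t_{1,n}} + 𝔖_{w_1^{(n−1,1)} t_{n−1,n}}, and for each k with 2 ≤ k ≤ n−2, 𝔖_{s_{n−1}} · 𝔖_{w_k^{(n−1,1)}} = 𝔖_{w_k^{(n−1,1)} t_{n−2,n}} + 𝔖_{w_k^{(n−1,1)} t_{n−1,n}}. -/

import Mathlib

open MvPolynomial Finset

/-- The product of simple transpositions `s_a s_{a-1} ⋯ s_b` (descending indices),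
where `s_r` interchanges `r` and `r+1`; the empty product (when `a < b`) is the identity. -/
def sdesc (a b : ℕ) : Equiv.Perm ℕ :=
  (((List.range' b (a + 1 - b)).reverse).map (fun r => Equiv.swap r (r + 1))).prod

/-- The product of simple transpositions `s_a s_{a+1} ⋯ s_b` (ascending indices);
the empty product (when `b < a`) is the identity. -/
def sasc (a b : ℕ) : Equiv.Perm ℕ :=
  ((List.range' a (b + 1 - a)).map (fun r => Equiv.swap r (r + 1))).prod

/-- The permutation `w_k^{(i,j)} = (s_{i-k} s_{i-k-1} ⋯ s_j)(s_{i-k+1} s_{i-k+2} ⋯ s_{i-1})`,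
regarded as a permutation of `ℕ` (supported on `{1, …, n}`). -/
def wkij (i j k : ℕ) : Equiv.Perm ℕ := sdesc (i - k) j * sasc (i - k + 1) (i - 1)

/-- The longest element `w_0 = [n, n-1, …, 1]` of `S_n`, as a permutation of `ℕ`. -/
def revPerm (n : ℕ) : Equiv.Perm ℕ :=
  Function.Involutive.toPerm (fun x => if 1 ≤ x ∧ x ≤ n then n + 1 - x else x)
    (fun x => by simp only; split_ifs <;> omega)

/-! ### Permutations supported on an initial segment -/

/-- `w` fixes every natural number outside `{1, …, n}`. -/
def SupportedUpTo (n : ℕ) (w : Equiv.Perm ℕ) : Prop :=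
  ∀ x, x ∉ Finset.Icc 1 n → w x = x

namespace SupportedUpTo

variable {n m : ℕ} {u w : Equiv.Perm ℕ}

theorem mono (h : n ≤ m) (hw : SupportedUpTo n w) : SupportedUpTo m w := by
  intro x hx
  apply hw
  simp only [Finset.mem_Icc] at hx ⊢
  omega

theorem mul (hu : SupportedUpTo n u) (hw : SupportedUpTo n w) : SupportedUpTo n (u * w) := by
  intro x hx
  rw [Equiv.Perm.mul_apply, hw x hx, hu x hx]

theorem swap {a b : ℕ} (ha : a ∈ Finset.Icc 1 n) (hb : b ∈ Finset.Icc 1 n) :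
    SupportedUpTo n (Equiv.swap a b) := by
  intro x hx
  refine Equiv.swap_apply_of_ne_of_ne ?_ ?_ <;> (rintro rfl; contradiction)

theorem mul_swap (hw : SupportedUpTo n w) {a b : ℕ} (ha : a ∈ Finset.Icc 1 n)
    (hb : b ∈ Finset.Icc 1 n) : SupportedUpTo n (w * Equiv.swap a b) :=
  hw.mul (swap ha hb)

theorem apply_mem (hw : SupportedUpTo n w) {x : ℕ} (hx : x ∈ Finset.Icc 1 n) :
    w x ∈ Finset.Icc 1 n := by
  by_contra h
  have := w.injective (hw _ h)
  exact h (this.symm ▸ hx)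

/-- A permutation of `{1, …, n}` without descents is the identity. -/
theorem eq_one (hw : SupportedUpTo n w)
    (h : ∀ r, 1 ≤ r → r < n → ¬ w (r + 1) < w r) : w = 1 := by
  have hmono : StrictMono w := by
    refine strictMono_nat_of_lt_succ fun x => ?_
    have hne : w x ≠ w (x + 1) := fun e => by simpa using w.injective e
    have h0 : w 0 = 0 := hw 0 (by simp)
    rcases Nat.eq_zero_or_pos x with rfl | hx
    · omega
    rcases lt_or_ge x n with hxn | hxn
    · have := h x hx hxn
      omega
    have h1 : w (x + 1) = x + 1 := hw _ (by simp only [Finset.mem_Icc]; omega)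
    rcases eq_or_lt_of_le hxn with rfl | hxn
    · have := hw.apply_mem (x := n) (by simp only [Finset.mem_Icc]; omega)
      simp only [Finset.mem_Icc] at this
      omega
    · have h2 : w x = x := hw _ (by simp only [Finset.mem_Icc]; omega)
      omega
  ext x
  have h1 := hmono.le_apply (x := x)
  refine le_antisymm ?_ h1
  rcases le_or_gt (w x) x with h2 | h2
  · exact h2
  · have := (show StrictMono (w.symm) from fun a b hab => by
      rw [← hmono.lt_iff_lt]; simpa using hab).le_apply (x := w x)
    simpa using this

end SupportedUpTo

theorem revPerm_apply (n x : ℕ) :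
    revPerm n x = if 1 ≤ x ∧ x ≤ n then n + 1 - x else x := rfl

theorem revPerm_apply_of_mem {n x : ℕ} (h1 : 1 ≤ x) (h2 : x ≤ n) : revPerm n x = n + 1 - x := by
  simp [revPerm_apply, h1, h2]

theorem revPerm_supportedUpTo (n : ℕ) : SupportedUpTo n (revPerm n) := by
  intro x hx
  simp only [Finset.mem_Icc] at hx
  simp [revPerm_apply, hx]

theorem revPerm_mul_self (n : ℕ) : revPerm n * revPerm n = 1 := by
  ext x
  exact (Function.Involutive.toPerm_involutive _ x)

/-- A permutation of `{1, …, n}` without ascents is the longest one. -/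
theorem SupportedUpTo.eq_revPerm {n : ℕ} {w : Equiv.Perm ℕ} (hw : SupportedUpTo n w)
    (h : ∀ r, 1 ≤ r → r < n → ¬ w r < w (r + 1)) : w = revPerm n := by
  have h1 : revPerm n * w = 1 := by
    refine ((revPerm_supportedUpTo n).mul hw).eq_one fun r h1 h2 => ?_
    have ha := hw.apply_mem (x := r) (by simp only [Finset.mem_Icc]; omega)
    have hb := hw.apply_mem (x := r + 1) (by simp only [Finset.mem_Icc]; omega)
    simp only [Finset.mem_Icc] at ha hb
    have := h r h1 h2
    rw [Equiv.Perm.mul_apply, Equiv.Perm.mul_apply, revPerm_apply_of_mem ha.1 ha.2,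
      revPerm_apply_of_mem hb.1 hb.2]
    omega
  calc w = revPerm n * (revPerm n * w) := by rw [← mul_assoc, revPerm_mul_self, one_mul]
    _ = revPerm n := by rw [h1, mul_one]

/-- A statistic on the permutations of `{1, …, n}` that increases when a descent is removed. -/
def posWeight (n : ℕ) (w : Equiv.Perm ℕ) : ℕ := ∑ i ∈ Finset.Icc 1 n, i * w i

theorem posWeight_lt_mul_swap {n r : ℕ} {w : Equiv.Perm ℕ} (h1 : 1 ≤ r) (h2 : r < n)
    (h : w (r + 1) < w r) : posWeight n w < posWeight n (w * Equiv.swap r (r + 1)) := by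
  have hr : r ∈ Finset.Icc 1 n := by simp only [Finset.mem_Icc]; omega
  have hr' : r + 1 ∈ (Finset.Icc 1 n).erase r := by
    simp only [Finset.mem_erase, Finset.mem_Icc]; omega
  unfold posWeight
  rw [← Finset.add_sum_erase _ _ hr, ← Finset.add_sum_erase _ _ hr',
    ← Finset.add_sum_erase (Finset.Icc 1 n) _ hr, ← Finset.add_sum_erase _ _ hr']
  have hsum : ∑ x ∈ ((Finset.Icc 1 n).erase r).erase (r + 1), x * (w * Equiv.swap r (r + 1)) x
      = ∑ x ∈ ((Finset.Icc 1 n).erase r).erase (r + 1), x * w x := by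
    refine Finset.sum_congr rfl fun x hx => ?_
    simp only [Finset.mem_erase] at hx
    rw [Equiv.Perm.mul_apply, Equiv.swap_apply_of_ne_of_ne hx.2.1 hx.1]
  rw [hsum, Equiv.Perm.mul_apply, Equiv.Perm.mul_apply, Equiv.swap_apply_left,
    Equiv.swap_apply_right]
  nlinarith

theorem posWeight_le {n : ℕ} {w : Equiv.Perm ℕ} (hw : SupportedUpTo n w) :
    posWeight n w ≤ n * (n * n) := by
  have : posWeight n w ≤ ∑ _i ∈ Finset.Icc 1 n, n * n := by
    refine Finset.sum_le_sum fun i hi => ?_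
    have := hw.apply_mem hi
    simp only [Finset.mem_Icc] at hi this
    exact Nat.mul_le_mul hi.2 this.2
  simpa using this

/-- Induction on permutations of `{1, …, n}`, removing descents down to the identity. -/
theorem SupportedUpTo.induction_up {n : ℕ} {P : Equiv.Perm ℕ → Prop}
    (step : ∀ w, SupportedUpTo n w →
      (∀ r, 1 ≤ r → r < n → w (r + 1) < w r → P (w * Equiv.swap r (r + 1))) → P w)
    (w : Equiv.Perm ℕ) (hw : SupportedUpTo n w) : P w := by
  induction hm : n * (n * n) - posWeight n w using Nat.strong_induction_on generalizing w with
  | _ m ih =>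
    refine step w hw fun r h1 h2 h => ?_
    have hw' : SupportedUpTo n (w * Equiv.swap r (r + 1)) :=
      hw.mul_swap (by simp only [Finset.mem_Icc]; omega) (by simp only [Finset.mem_Icc]; omega)
    have ha := posWeight_lt_mul_swap h1 h2 h
    have hb := posWeight_le hw'
    exact ih _ (by omega) _ hw' rfl

/-- Induction on permutations of `{1, …, n}`, starting from the longest one and removing
descents. -/
theorem SupportedUpTo.induction_down {n : ℕ} {P : Equiv.Perm ℕ → Prop} (top : P (revPerm n))
    (step : ∀ w, SupportedUpTo n w → P w →
      ∀ r, 1 ≤ r → r < n → w (r + 1) < w r → P (w * Equiv.swap r (r + 1)))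
    (w : Equiv.Perm ℕ) (hw : SupportedUpTo n w) : P w := by
  induction hm : posWeight n w using Nat.strong_induction_on generalizing w with
  | _ m ih =>
    by_cases hasc : ∀ r, 1 ≤ r → r < n → ¬ w r < w (r + 1)
    · rw [hw.eq_revPerm hasc]
      exact top
    push Not at hasc
    obtain ⟨r, h1, h2, h⟩ := hasc
    have hw' : SupportedUpTo n (w * Equiv.swap r (r + 1)) :=
      hw.mul_swap (by simp only [Finset.mem_Icc]; omega) (by simp only [Finset.mem_Icc]; omega)
    have hd : (w * Equiv.swap r (r + 1)) (r + 1) < (w * Equiv.swap r (r + 1)) r := by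
      simpa using h
    have hself : w * Equiv.swap r (r + 1) * Equiv.swap r (r + 1) = w := by
      rw [mul_assoc, Equiv.swap_mul_self, mul_one]
    have ha := posWeight_lt_mul_swap h1 h2 hd
    rw [hself] at ha
    have := step _ hw' (ih _ (by omega) _ hw' rfl) r h1 h2 hd
    rwa [hself] at this

/-! ### Polynomials and divided differences -/

theorem MvPolynomial.IsHomogeneous.of_mul_left {σ R : Type*} [CommRing R] [IsDomain R]
    {a g : MvPolynomial σ R} {i d : ℕ} (ha : a.IsHomogeneous i) (ha0 : a ≠ 0)
    (h : (a * g).IsHomogeneous d) : ∃ e, g.IsHomogeneous e := by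
  have key : ∀ j, i + j ≠ d → homogeneousComponent j g = 0 := by
    intro j hj
    let := MvPolynomial.gradedAlgebra (σ := σ) (R := R)
    have h1 := DirectSum.coe_decompose_mul_add_of_left_mem (homogeneousSubmodule σ R)
      (a := a) (b := g) (i := i) (j := j) ha
    have h2 : homogeneousComponent (i + j) (a * g) = a * homogeneousComponent j g := by
      rw [← decomposition.decompose'_apply, ← decomposition.decompose'_apply]
      exact h1
    rw [homogeneousComponent_of_mem h, if_neg hj] at h2
    exact (mul_eq_zero.1 h2.symm).resolve_left ha0
  refine ⟨d - i, ?_⟩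
  rw [← sum_homogeneousComponent g]
  refine IsHomogeneous.sum _ _ _ fun j _ => ?_
  by_cases hj : i + j = d
  · have : d - i = j := by omega
    rw [this]
    exact homogeneousComponent_isHomogeneous j g
  · rw [key j hj]
    exact isHomogeneous_zero _ _ _

theorem X_sub_X_ne_zero (r : ℕ) : (X r - X (r + 1) : MvPolynomial ℕ ℤ) ≠ 0 := by
  rw [sub_ne_zero]
  intro h
  have := X_injective h
  omega

theorem degreeOf_X_sub_X_left (r : ℕ) :
    degreeOf r (X r - X (r + 1) : MvPolynomial ℕ ℤ) = 1 := by
  rw [sub_eq_add_neg, degreeOf_add_eq_of_degreeOf_lt] <;> simp [degreeOf_neg, degreeOf_X]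

theorem degreeOf_X_sub_X_right (r : ℕ) :
    degreeOf (r + 1) (X r - X (r + 1) : MvPolynomial ℕ ℤ) = 1 := by
  rw [← neg_sub, degreeOf_neg, sub_eq_add_neg, degreeOf_add_eq_of_degreeOf_lt] <;>
    simp [degreeOf_neg, degreeOf_X]

theorem degreeOf_rename_swap (a b i : ℕ) (f : MvPolynomial ℕ ℤ) :
    degreeOf i (rename (Equiv.swap a b) f) = degreeOf (Equiv.swap a b i) f := by
  have := degreeOf_rename_of_injective (p := f) (Equiv.swap a b).injective (Equiv.swap a b i)
  simpa using this

/-- A polynomial in `x_1, …, x_{n-1}` that is symmetric in `x_1, …, x_n` is constant. -/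
theorem eq_C_of_rename_swap_eq {n : ℕ} {f : MvPolynomial ℕ ℤ}
    (hsymm : ∀ r, 1 ≤ r → r < n → rename (Equiv.swap r (r + 1)) f = f)
    (hdeg : ∀ i, i = 0 ∨ n ≤ i → degreeOf i f = 0) : f = C (constantCoeff f) := by
  have key : ∀ j i, 1 ≤ i → i + j = n → degreeOf i f = 0 := by
    intro j
    induction j with
    | zero => intro i _ h; exact hdeg i (by omega)
    | succ j ih =>
      intro i h1 h
      have := degreeOf_rename_swap i (i + 1) i f
      rw [hsymm i h1 (by omega), Equiv.swap_apply_left, ih (i + 1) (by omega) (by omega)] at this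
      exact this
  have hvars : f.vars = ∅ := by
    rw [Finset.eq_empty_iff_forall_notMem]
    intro i hi
    rw [mem_vars_iff_degreeOf_ne_zero] at hi
    rcases Nat.eq_zero_or_pos i with h | h
    · exact hi (hdeg i (Or.inl h))
    · rcases le_or_gt n i with h' | h'
      · exact hi (hdeg i (Or.inr h'))
      · exact hi (key (n - i) i h (by omega))
  exact vars_eq_empty_iff_eq_C.1 hvars

/-! ### Families of Schubert polynomials -/

/-- The defining properties of the Schubert polynomials of `S_n`. -/
structure IsSchubertFamily (n : ℕ) (S : Equiv.Perm ℕ → MvPolynomial ℕ ℤ) : Prop where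
  top : S (revPerm n) = ∏ r ∈ Finset.Icc 1 (n - 1), X r ^ (n - r)
  divDiff : ∀ w : Equiv.Perm ℕ, SupportedUpTo n w →
    ∀ r, 1 ≤ r → r < n → w (r + 1) < w r →
      S w - rename (⇑(Equiv.swap r (r + 1))) (S w)
        = (X r - X (r + 1)) * S (w * Equiv.swap r (r + 1))

namespace IsSchubertFamily

variable {n : ℕ} {S : Equiv.Perm ℕ → MvPolynomial ℕ ℤ} {w : Equiv.Perm ℕ}

theorem rename_eq_of_lt (hS : IsSchubertFamily n S) (hw : SupportedUpTo n w) {r : ℕ}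
    (h1 : 1 ≤ r) (h2 : r < n) (h : w r < w (r + 1)) :
    rename (Equiv.swap r (r + 1)) (S w) = S w := by
  have hw' : SupportedUpTo n (w * Equiv.swap r (r + 1)) :=
    hw.mul_swap (by simp only [Finset.mem_Icc]; omega) (by simp only [Finset.mem_Icc]; omega)
  have hd := hS.divDiff _ hw' r h1 h2 (by simpa using h)
  rw [mul_assoc, Equiv.swap_mul_self, mul_one] at hd
  have hd' := congrArg (rename (Equiv.swap r (r + 1))) hd
  have hinv : ∀ f : MvPolynomial ℕ ℤ,
      rename (Equiv.swap r (r + 1)) (rename (Equiv.swap r (r + 1)) f) = f := by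
    intro f
    rw [rename_rename, ← Equiv.Perm.coe_mul, Equiv.swap_mul_self]
    exact rename_id_apply f
  simp only [map_sub, map_mul, hinv, rename_X, Equiv.swap_apply_left,
    Equiv.swap_apply_right] at hd'
  refine mul_left_cancel₀ (X_sub_X_ne_zero r) ?_
  linear_combination hd + hd'

theorem degreeOf_le (hS : IsSchubertFamily n S) (hw : SupportedUpTo n w) :
    ∀ i, degreeOf i (S w) ≤ if 1 ≤ i then n - i else 0 := by
  refine SupportedUpTo.induction_down
    (P := fun w => ∀ i, degreeOf i (S w) ≤ if 1 ≤ i then n - i else 0) ?_ ?_ w hw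
  · intro i
    rw [hS.top]
    refine (degreeOf_prod_le _ _ _).trans ?_
    calc ∑ j ∈ Finset.Icc 1 (n - 1), degreeOf i (X j ^ (n - j) : MvPolynomial ℕ ℤ)
        ≤ ∑ j ∈ Finset.Icc 1 (n - 1), if i = j then n - j else 0 := by
          refine Finset.sum_le_sum fun j _ => (degreeOf_pow_le _ _ _).trans ?_
          rw [degreeOf_X]
          split_ifs <;> simp
      _ ≤ if 1 ≤ i then n - i else 0 := by
          rw [Finset.sum_ite_eq]
          simp only [Finset.mem_Icc]
          split_ifs <;> omega
  · intro w hw ih r h1 h2 h i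
    set g := S (w * Equiv.swap r (r + 1)) with hg
    by_cases hg0 : g = 0
    · simp [hg0]
    have hd := hS.divDiff w hw r h1 h2 h
    have hle : degreeOf i (X r - X (r + 1) : MvPolynomial ℕ ℤ) + degreeOf i g
        ≤ max (degreeOf i (S w)) (degreeOf (Equiv.swap r (r + 1) i) (S w)) := by
      rw [← degreeOf_mul_eq (X_sub_X_ne_zero r) hg0, ← hd, ← degreeOf_rename_swap]
      exact degreeOf_sub_le _ _ _
    have ha := ih r
    have hb := ih (r + 1)
    have hi := ih i
    rcases eq_or_ne i r with rfl | hir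
    · rw [degreeOf_X_sub_X_left, Equiv.swap_apply_left] at hle
      split_ifs at * <;> omega
    rcases eq_or_ne i (r + 1) with rfl | hir'
    · rw [degreeOf_X_sub_X_right, Equiv.swap_apply_right] at hle
      split_ifs at * <;> omega
    · rw [Equiv.swap_apply_of_ne_of_ne hir hir', max_self] at hle
      omega

theorem exists_isHomogeneous (hS : IsSchubertFamily n S) (hw : SupportedUpTo n w) :
    ∃ d, (S w).IsHomogeneous d := by
  refine SupportedUpTo.induction_down (P := fun w => ∃ d, (S w).IsHomogeneous d) ?_ ?_ w hw
  · rw [hS.top]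
    exact ⟨_, IsHomogeneous.prod _ _ _ fun r _ => (isHomogeneous_X ℤ r).pow _⟩
  · rintro w hw ⟨d, ih⟩ r h1 h2 h
    have hd := hS.divDiff w hw r h1 h2 h
    refine IsHomogeneous.of_mul_left
      ((isHomogeneous_X ℤ r).sub (isHomogeneous_X ℤ (r + 1))) (X_sub_X_ne_zero r) (d := d) ?_
    rw [← hd]
    exact ih.sub ih.rename_isHomogeneous

/-- Removing a descent `r` from a permutation whose Schubert polynomial is `x_r * M`, with `M`
symmetric in `x_r` and `x_{r+1}`. -/
theorem mul_swap_eq_of_eq_X_mul (hS : IsSchubertFamily n S) (hw : SupportedUpTo n w) {r : ℕ}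
    (h1 : 1 ≤ r) (h2 : r < n) (h : w (r + 1) < w r) {M : MvPolynomial ℕ ℤ}
    (hM : rename (Equiv.swap r (r + 1)) M = M) (hSw : S w = X r * M) :
    S (w * Equiv.swap r (r + 1)) = M := by
  have hd := hS.divDiff w hw r h1 h2 h
  rw [hSw, map_mul, hM, rename_X, Equiv.swap_apply_left, ← sub_mul] at hd
  exact (mul_left_cancel₀ (X_sub_X_ne_zero r) hd).symm

theorem rename_swap_prod_X_pow {r : ℕ} {s : Finset ℕ} (h1 : r ∈ s) (h2 : r + 1 ∈ s) {a : ℕ → ℕ}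
    (ha : a r = a (r + 1)) :
    rename (Equiv.swap r (r + 1)) (∏ i ∈ s, (X i : MvPolynomial ℕ ℤ) ^ a i)
      = ∏ i ∈ s, X i ^ a i := by
  rw [map_prod]
  refine Finset.prod_equiv (Equiv.swap r (r + 1)) (fun i => ?_) (fun i _ => ?_)
  · rcases eq_or_ne i r with rfl | hir
    · simp [h1, h2]
    rcases eq_or_ne i (r + 1) with rfl | hir'
    · simp [h1, h2]
    · rw [Equiv.swap_apply_of_ne_of_ne hir hir']
  · rw [map_pow, rename_X]
    congr 1
    rcases eq_or_ne i r with rfl | hir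
    · simp [ha]
    rcases eq_or_ne i (r + 1) with rfl | hir'
    · simp [ha]
    · rw [Equiv.swap_apply_of_ne_of_ne hir hir']

/-- The permutations obtained from `[m + 1, m, …, 1]` by moving the entry `m + 1` to the right
have monomial Schubert polynomials. -/
theorem exists_eq_prod_X_pow (hS : IsSchubertFamily n S) {m : ℕ} (hm : m < n)
    (h : S (revPerm (m + 1)) = ∏ i ∈ Finset.Icc 1 n, X i ^ (m + 1 - i)) (j : ℕ) (hj : j ≤ m) :
    ∃ v, SupportedUpTo (m + 1) v ∧ (∀ x, 1 ≤ x → x ≤ j → v x = m + 1 - x) ∧ v (j + 1) = m + 1 ∧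
      (∀ x, j + 2 ≤ x → v x = revPerm (m + 1) x) ∧
      S v = ∏ i ∈ Finset.Icc 1 n, X i ^ (if i ≤ j then m - i else m + 1 - i) := by
  induction j with
  | zero =>
    refine ⟨_, revPerm_supportedUpTo _, by omega, ?_, fun _ _ => rfl, ?_⟩
    · rw [revPerm_apply_of_mem] <;> omega
    · rw [h]
      refine Finset.prod_congr rfl fun i hi => ?_
      rw [Finset.mem_Icc] at hi
      rw [if_neg (by omega)]
  | succ j ih =>
    obtain ⟨v, hv, hlow, hmid, hhigh, hSv⟩ := ih (by omega)
    have h2 : v (j + 2) = m - j := by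
      rw [hhigh _ le_rfl, revPerm_apply_of_mem] <;> omega
    refine ⟨v * Equiv.swap (j + 1) (j + 2), hv.mul_swap ?_ ?_, ?_, ?_, ?_, ?_⟩
    · simp only [Finset.mem_Icc]; omega
    · simp only [Finset.mem_Icc]; omega
    · intro x hx1 hx2
      rw [Equiv.Perm.mul_apply]
      rcases eq_or_ne x (j + 1) with rfl | hne
      · rw [Equiv.swap_apply_left, h2]
        omega
      · rw [Equiv.swap_apply_of_ne_of_ne hne (by omega), hlow x hx1 (by omega)]
    · rw [Equiv.Perm.mul_apply, Equiv.swap_apply_right, hmid]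
    · intro x hx
      rw [Equiv.Perm.mul_apply, Equiv.swap_apply_of_ne_of_ne (by omega) (by omega),
        hhigh x (by omega)]
    · have hmem : j + 1 ∈ Finset.Icc 1 n := by simp only [Finset.mem_Icc]; omega
      refine hS.mul_swap_eq_of_eq_X_mul (hv.mono hm) (by omega) (by omega)
        (by rw [show v (j + 1 + 1) = m - j from h2, hmid]; omega) ?_ ?_
      · refine rename_swap_prod_X_pow hmem (by simp only [Finset.mem_Icc]; omega) ?_
        split_ifs <;> omega
      · rw [hSv, ← Finset.mul_prod_erase _ _ hmem, ← Finset.mul_prod_erase _ _ hmem, ← mul_assoc]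
        congr 1
        · rw [if_neg (by omega), if_pos le_rfl, ← pow_succ']
          congr 1
          omega
        · refine Finset.prod_congr rfl fun i hi => ?_
          rw [Finset.mem_erase] at hi
          congr 1
          split_ifs <;> omega

theorem revPerm_eq_prod_X_pow (hS : IsSchubertFamily n S) (j : ℕ) (hj : j ≤ n) :
    S (revPerm (n - j)) = ∏ i ∈ Finset.Icc 1 n, X i ^ (n - j - i) := by
  induction j with
  | zero =>
    rw [Nat.sub_zero, hS.top]
    refine Finset.prod_subset (Finset.Icc_subset_Icc_right (by omega)) fun i hi hi' => ?_
    simp only [Finset.mem_Icc] at hi hi'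
    rw [show n - i = 0 by omega, pow_zero]
  | succ j ih =>
    obtain ⟨m, hm⟩ : ∃ m, n - j = m + 1 := ⟨n - j - 1, by omega⟩
    have ih := ih (by omega)
    rw [hm] at ih
    obtain ⟨v, hv, hlow, hmid, -, hSv⟩ := hS.exists_eq_prod_X_pow (by omega) ih m le_rfl
    have hrev : revPerm m = v := by
      ext x
      rw [revPerm_apply]
      split_ifs with hx
      · exact (hlow x hx.1 hx.2).symm
      · rcases eq_or_ne x (m + 1) with rfl | hne
        · exact hmid.symm
        · exact (hv x (by simp only [Finset.mem_Icc]; omega)).symm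
    rw [show n - (j + 1) = m by omega, hrev, hSv]
    refine Finset.prod_congr rfl fun i _ => ?_
    congr 1
    split_ifs <;> omega

theorem one_eq_one (hS : IsSchubertFamily n S) : S 1 = 1 := by
  have h := hS.revPerm_eq_prod_X_pow n le_rfl
  have h0 : revPerm (n - n) = 1 := by
    ext x
    simp [revPerm_apply]
    omega
  rw [h0] at h
  simpa using h

theorem ne_zero (hS : IsSchubertFamily n S) (hw : SupportedUpTo n w) : S w ≠ 0 := by
  refine SupportedUpTo.induction_up (P := fun w => S w ≠ 0) ?_ w hw
  intro w hw ih h0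
  by_cases h : ∀ r, 1 ≤ r → r < n → ¬ w (r + 1) < w r
  · rw [hw.eq_one h, hS.one_eq_one] at h0
    exact one_ne_zero h0
  · push Not at h
    obtain ⟨r, h1, h2, h⟩ := h
    have hd := hS.divDiff w hw r h1 h2 h
    rw [h0, map_zero, sub_zero, eq_comm] at hd
    exact (mul_ne_zero (X_sub_X_ne_zero r) (ih r h1 h2 h)) hd

theorem constantCoeff_eq_zero (hS : IsSchubertFamily n S) (hw : SupportedUpTo n w) (h1 : w ≠ 1) :
    constantCoeff (S w) = 0 := by
  obtain ⟨d, hd⟩ := hS.exists_isHomogeneous hw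
  rcases Nat.eq_zero_or_pos d with rfl | hpos
  · exfalso
    have hC : S w = C (coeff 0 (S w)) := by
      rw [← totalDegree_zero_iff_isHomogeneous] at hd
      exact totalDegree_eq_zero_iff_eq_C.1 hd
    refine h1 (hw.eq_one fun r h1 h2 h => ?_)
    have hdd := hS.divDiff w hw r h1 h2 h
    rw [hC, rename_C, sub_self, eq_comm] at hdd
    refine mul_ne_zero (X_sub_X_ne_zero r) (hS.ne_zero (hw.mul_swap ?_ ?_)) hdd <;>
      (simp only [Finset.mem_Icc]; omega)
  · exact hd.coeff_eq_zero (by simp; omega)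

end IsSchubertFamily

/-! ### Monk's rule for the last simple transposition -/

/-- The positions `p < n` such that `w p` exceeds all entries of `w` strictly between the
positions `p` and `n`. -/
def rightMaxima (n : ℕ) (w : Equiv.Perm ℕ) : Finset ℕ :=
  (Finset.Icc 1 (n - 1)).filter fun p => ∀ j ∈ Finset.Ioo p n, w j < w p

theorem mem_rightMaxima {n p : ℕ} {w : Equiv.Perm ℕ} :
    p ∈ rightMaxima n w ↔ (1 ≤ p ∧ p ≤ n - 1) ∧ ∀ j, p < j → j < n → w j < w p := by
  simp [rightMaxima]

theorem mem_rightMaxima_mul_swap_iff {n r p : ℕ} {w : Equiv.Perm ℕ} (h2 : r + 1 < n)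
    (hp : p ≠ r) (hp' : p ≠ r + 1) :
    p ∈ rightMaxima n (w * Equiv.swap r (r + 1)) ↔ p ∈ rightMaxima n w := by
  simp only [mem_rightMaxima, Equiv.Perm.mul_apply, Equiv.swap_apply_of_ne_of_ne hp hp']
  refine and_congr_right fun _ => ⟨fun h j hj hj' => ?_, fun h j hj hj' => ?_⟩
  · have := h (Equiv.swap r (r + 1) j)
    rw [Equiv.swap_apply_self] at this
    refine this ?_ ?_ <;> rw [Equiv.swap_apply_def] <;> split_ifs <;> omega
  · refine h _ ?_ ?_ <;> rw [Equiv.swap_apply_def] <;> split_ifs <;> omega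

theorem rightMaxima_mul_swap {n r : ℕ} {w : Equiv.Perm ℕ} (h1 : 1 ≤ r) (h2 : r + 1 < n)
    (h : w (r + 1) < w r) :
    rightMaxima n (w * Equiv.swap r (r + 1))
      = ((rightMaxima n w).erase (r + 1)).image (Equiv.swap r (r + 1)) := by
  ext p
  have hmem : p ∈ ((rightMaxima n w).erase (r + 1)).image (Equiv.swap r (r + 1))
      ↔ Equiv.swap r (r + 1) p ≠ r + 1 ∧ Equiv.swap r (r + 1) p ∈ rightMaxima n w := by
    rw [Finset.mem_image]
    constructor
    · rintro ⟨q, hq, rfl⟩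
      simpa using hq
    · intro hp
      exact ⟨_, Finset.mem_erase.2 hp, Equiv.swap_apply_self _ _ _⟩
  rw [hmem]
  rcases eq_or_ne p r with rfl | hne
  · simp only [Equiv.swap_apply_left, ne_eq, not_true_eq_false, false_and, iff_false,
      mem_rightMaxima, not_and]
    intro _ hmax
    have := hmax (p + 1) (by omega) h2
    simp only [Equiv.Perm.mul_apply, Equiv.swap_apply_left, Equiv.swap_apply_right] at this
    omega
  rcases eq_or_ne p (r + 1) with rfl | hne'
  · simp only [Equiv.swap_apply_right, mem_rightMaxima, Equiv.Perm.mul_apply]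
    refine ⟨fun hmax => ⟨by omega, by omega, fun j hj hj' => ?_⟩,
      fun hmax => ⟨by omega, fun j hj hj' => ?_⟩⟩
    · rcases eq_or_ne j (r + 1) with rfl | hj''
      · exact h
      · have := hmax.2 j (by omega) hj'
        rwa [Equiv.swap_apply_of_ne_of_ne (by omega) hj''] at this
    · rw [Equiv.swap_apply_of_ne_of_ne (by omega) (by omega)]
      exact hmax.2.2 j (by omega) hj'
  · rw [mem_rightMaxima_mul_swap_iff h2 hne hne', Equiv.swap_apply_of_ne_of_ne hne hne']
    exact ⟨fun hp => ⟨hne', hp⟩, fun hp => hp.2⟩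

namespace IsSchubertFamily

variable {n : ℕ} {S : Equiv.Perm ℕ → MvPolynomial ℕ ℤ} {w : Equiv.Perm ℕ}

theorem swap_last_supportedUpTo {p : ℕ} (h1 : 1 ≤ p) (h2 : p ≤ n) :
    SupportedUpTo n (Equiv.swap p n) :=
  .swap (by simp only [Finset.mem_Icc]; omega) (by simp only [Finset.mem_Icc]; omega)

theorem rename_swap_last_of_lt (hS : IsSchubertFamily n S) {r : ℕ} (h1 : 1 ≤ r)
    (h2 : r + 1 < n) :
    rename (Equiv.swap r (r + 1)) (S (Equiv.swap (n - 1) n)) = S (Equiv.swap (n - 1) n) := by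
  refine hS.rename_eq_of_lt (swap_last_supportedUpTo (by omega) (by omega)) h1 (by omega) ?_
  rw [Equiv.swap_apply_of_ne_of_ne (x := r) (by omega) (by omega), Equiv.swap_apply_def]
  split_ifs <;> omega

theorem divDiff_swap_last (hS : IsSchubertFamily n S) (hn : 2 ≤ n) :
    S (Equiv.swap (n - 1) n) - rename (Equiv.swap (n - 1) n) (S (Equiv.swap (n - 1) n))
      = X (n - 1) - X n := by
  have hn' : n - 1 + 1 = n := by omega
  have h := hS.divDiff (Equiv.swap (n - 1) n) (swap_last_supportedUpTo (by omega) (by omega))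
    (n - 1) (by omega) (by omega)
  rw [hn', Equiv.swap_apply_left, Equiv.swap_apply_right, Equiv.swap_mul_self, hS.one_eq_one,
    mul_one] at h
  exact h (by omega)

/-- The effect on Monk's rule of a divided difference at a descent before the last position. -/
theorem sum_rightMaxima_divDiff (hS : IsSchubertFamily n S) (hw : SupportedUpTo (n - 1) w) {r : ℕ}
    (h1 : 1 ≤ r) (h2 : r + 1 < n) (h : w (r + 1) < w r) :
    ∑ p ∈ rightMaxima n w, S (w * Equiv.swap p n)
        - rename (Equiv.swap r (r + 1)) (∑ p ∈ rightMaxima n w, S (w * Equiv.swap p n))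
      = (X r - X (r + 1)) * ∑ p ∈ rightMaxima n (w * Equiv.swap r (r + 1)),
          S (w * Equiv.swap r (r + 1) * Equiv.swap p n) := by
  have hwn : w n = n := hw n (by simp only [Finset.mem_Icc]; omega)
  have hlt : ∀ x, 1 ≤ x → x < n → w x < n := fun x hx hx' => by
    have := hw.apply_mem (x := x) (by simp only [Finset.mem_Icc]; omega)
    simp only [Finset.mem_Icc] at this
    omega
  have hsupp : ∀ p ∈ rightMaxima n w, SupportedUpTo n (w * Equiv.swap p n) := fun p hp => by
    rw [mem_rightMaxima] at hp
    exact (hw.mono (by omega)).mul (swap_last_supportedUpTo (by omega) (by omega))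
  rw [rightMaxima_mul_swap h1 h2 h,
    Finset.sum_image (Equiv.swap r (r + 1)).injective.injOn, map_sum, ← Finset.sum_sub_distrib,
    Finset.mul_sum]
  rw [← Finset.sum_subset (Finset.erase_subset (r + 1) (rightMaxima n w))]
  · refine Finset.sum_congr rfl fun p hp => ?_
    rw [Finset.mem_erase] at hp
    have hp' := mem_rightMaxima.1 hp.2
    have hcomm : w * Equiv.swap r (r + 1) * Equiv.swap (Equiv.swap r (r + 1) p) n
        = w * Equiv.swap p n * Equiv.swap r (r + 1) := by
      have hc := Equiv.mul_swap_eq_swap_mul (Equiv.swap r (r + 1)) (Equiv.swap r (r + 1) p) n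
      rw [Equiv.swap_apply_self,
        Equiv.swap_apply_of_ne_of_ne (x := n) (by omega) (by omega)] at hc
      rw [mul_assoc, hc, mul_assoc]
    rw [hcomm]
    refine hS.divDiff _ (hsupp p hp.2) r h1 (by omega) ?_
    rw [Equiv.Perm.mul_apply, Equiv.Perm.mul_apply,
      Equiv.swap_apply_of_ne_of_ne (Ne.symm hp.1) (by omega)]
    rcases eq_or_ne p r with rfl | hpr
    · rw [Equiv.swap_apply_left, hwn]
      exact hlt _ (by omega) h2
    · rwa [Equiv.swap_apply_of_ne_of_ne hpr.symm (by omega)]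
  · intro p hp hp'
    obtain rfl : p = r + 1 := by
      by_contra hne
      exact hp' (Finset.mem_erase.2 ⟨hne, hp⟩)
    rw [sub_eq_zero, eq_comm]
    refine hS.rename_eq_of_lt (hsupp _ hp) h1 (by omega) ?_
    rw [Equiv.Perm.mul_apply, Equiv.Perm.mul_apply, Equiv.swap_apply_left, hwn,
      Equiv.swap_apply_of_ne_of_ne (by omega) (by omega)]
    exact hlt r h1 (by omega)

/-- Monk's rule for `𝔖_{s_{n-1}}` and a permutation of `{1, …, n - 1}`. -/
theorem monk_last (hS : IsSchubertFamily n S) (hn : 2 ≤ n) (hw : SupportedUpTo (n - 1) w) :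
    S (Equiv.swap (n - 1) n) * S w = ∑ p ∈ rightMaxima n w, S (w * Equiv.swap p n) := by
  refine SupportedUpTo.induction_up (P := fun w => S (Equiv.swap (n - 1) n) * S w
    = ∑ p ∈ rightMaxima n w, S (w * Equiv.swap p n)) ?_ w hw
  intro w hw ih
  have hwn : w n = n := hw n (by simp only [Finset.mem_Icc]; omega)
  have hlt : ∀ x, 1 ≤ x → x < n → w x < n := fun x hx hx' => by
    have := hw.apply_mem (x := x) (by simp only [Finset.mem_Icc]; omega)
    simp only [Finset.mem_Icc] at this
    omega
  have hsupp : ∀ p ∈ rightMaxima n w, SupportedUpTo n (w * Equiv.swap p n) := fun p hp => by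
    rw [mem_rightMaxima] at hp
    exact (hw.mono (by omega)).mul (swap_last_supportedUpTo (by omega) (by omega))
  have hws : SupportedUpTo n w := hw.mono (by omega)
  have hs : SupportedUpTo n (Equiv.swap (n - 1) n) :=
    swap_last_supportedUpTo (by omega) (by omega)
  rw [← sub_eq_zero]
  set D := S (Equiv.swap (n - 1) n) * S w - ∑ p ∈ rightMaxima n w, S (w * Equiv.swap p n) with hD
  have hsymm : ∀ r, 1 ≤ r → r < n → rename (Equiv.swap r (r + 1)) D = D := by
    intro r h1 h2
    rw [hD, map_sub, map_mul]
    rcases eq_or_lt_of_le (Nat.succ_le_of_lt h2) with hr | hr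
    · obtain rfl : n = r + 1 := hr.symm
      rw [Nat.add_sub_cancel] at *
      have hlast : r ∈ rightMaxima (r + 1) w := by
        rw [mem_rightMaxima]
        exact ⟨by omega, fun j _ _ => by omega⟩
      have h3 := hS.divDiff_swap_last hn
      rw [Nat.add_sub_cancel] at h3
      have h4 := hS.rename_eq_of_lt hws h1 h2 (by rw [hwn]; exact hlt r h1 h2)
      have h5 := hS.divDiff _ (hsupp r hlast) r h1 h2 (by
        simpa [hwn] using hlt r h1 h2)
      rw [mul_assoc, Equiv.swap_mul_self, mul_one] at h5
      have h6 : rename (Equiv.swap r (r + 1))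
          (∑ p ∈ (rightMaxima (r + 1) w).erase r, S (w * Equiv.swap p (r + 1)))
          = ∑ p ∈ (rightMaxima (r + 1) w).erase r, S (w * Equiv.swap p (r + 1)) := by
        rw [map_sum]
        refine Finset.sum_congr rfl fun p hp => ?_
        rw [Finset.mem_erase] at hp
        refine hS.rename_eq_of_lt (hsupp p hp.2) h1 h2 ?_
        have hp' := mem_rightMaxima.1 hp.2
        rw [Equiv.Perm.mul_apply, Equiv.Perm.mul_apply, Equiv.swap_apply_right,
          Equiv.swap_apply_of_ne_of_ne (Ne.symm hp.1) (by omega)]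
        exact hp'.2 r (by omega) (by omega)
      rw [h4, ← Finset.add_sum_erase _ _ hlast, map_add, h6]
      linear_combination h5 - S w * h3
    · rw [hS.rename_swap_last_of_lt h1 hr]
      rcases lt_or_ge (w (r + 1)) (w r) with h | h
      · have h3 := hS.sum_rightMaxima_divDiff hw h1 hr h
        rw [← ih r h1 (by omega) h] at h3
        have h4 := hS.divDiff w hws r h1 h2 h
        linear_combination h3 - S (Equiv.swap (n - 1) n) * h4
      · have hne : w r ≠ w (r + 1) := fun e => by simpa using w.injective e
        rw [hS.rename_eq_of_lt hws h1 h2 (by omega), map_sum]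
        congr 1
        refine Finset.sum_congr rfl fun p hp => ?_
        refine hS.rename_eq_of_lt (hsupp p hp) h1 h2 ?_
        rw [mem_rightMaxima] at hp
        have hpr : p ≠ r := by
          rintro rfl
          have := hp.2 (p + 1) (by omega) hr
          omega
        rw [Equiv.Perm.mul_apply, Equiv.Perm.mul_apply,
          Equiv.swap_apply_of_ne_of_ne hpr.symm h2.ne]
        rcases eq_or_ne p (r + 1) with rfl | hpr'
        · rw [Equiv.swap_apply_left, hwn]
          exact hlt r h1 h2
        · rw [Equiv.swap_apply_of_ne_of_ne hpr'.symm hr.ne]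
          omega
  have hdeg0 : ∀ u, SupportedUpTo n u → ∀ i, i = 0 ∨ n ≤ i → degreeOf i (S u) = 0 := by
    intro u hu i hi
    have := hS.degreeOf_le hu i
    split_ifs at this <;> omega
  have hdeg : ∀ i, i = 0 ∨ n ≤ i → degreeOf i D = 0 := by
    intro i hi
    have h1 := degreeOf_mul_le i (S (Equiv.swap (n - 1) n)) (S w)
    rw [hdeg0 _ hs i hi, hdeg0 _ hws i hi] at h1
    have h2 := degreeOf_sum_le i (rightMaxima n w) fun p => S (w * Equiv.swap p n)
    have h3 : (rightMaxima n w).sup (fun p => degreeOf i (S (w * Equiv.swap p n))) ≤ 0 :=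
      Finset.sup_le fun p hp => (hdeg0 _ (hsupp p hp) i hi).le
    have h4 := degreeOf_sub_le i (S (Equiv.swap (n - 1) n) * S w)
      (∑ p ∈ rightMaxima n w, S (w * Equiv.swap p n))
    rw [← hD] at h4
    omega
  rw [eq_C_of_rename_swap_eq hsymm hdeg, hD, map_sub, map_mul, map_sum,
    hS.constantCoeff_eq_zero hs, zero_mul, Finset.sum_eq_zero, sub_zero, C_0]
  · intro p hp
    refine hS.constantCoeff_eq_zero (hsupp p hp) fun h => ?_
    rw [mem_rightMaxima] at hp
    have := hlt p (by omega) (by omega)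
    have h' := congrArg (fun u : Equiv.Perm ℕ => u n) h
    simp at h'
    omega
  · intro h
    have h' := congrArg (fun u : Equiv.Perm ℕ => u n) h
    simp at h'
    omega

end IsSchubertFamily

/-! ### The permutations `w_k^{(i,1)}` -/

theorem sdesc_succ_one (a : ℕ) :
    sdesc (a + 1) 1 = Equiv.swap (a + 1) (a + 2) * sdesc a 1 := by
  simp [sdesc, List.range'_concat, add_comm 1]

theorem sdesc_one_apply (a x : ℕ) :
    sdesc a 1 x = if x = 1 then a + 1 else if 2 ≤ x ∧ x ≤ a + 1 then x - 1 else x := by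
  induction a with
  | zero =>
    have : sdesc 0 1 = 1 := by simp [sdesc]
    rw [this, Equiv.Perm.one_apply]
    split_ifs <;> omega
  | succ a ih =>
    rw [sdesc_succ_one, Equiv.Perm.mul_apply, ih, Equiv.swap_apply_def]
    split_ifs <;> omega

theorem sasc_apply (a l x : ℕ) :
    (((List.range' a l).map fun r => Equiv.swap r (r + 1)).prod : Equiv.Perm ℕ) x
      = if x = a + l then a else if a ≤ x ∧ x < a + l then x + 1 else x := by
  induction l generalizing x with
  | zero =>
    rw [List.range'_zero, List.map_nil, List.prod_nil, Equiv.Perm.one_apply]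
    split_ifs <;> omega
  | succ l ih =>
    rw [List.range'_concat, List.map_append, List.prod_append, Equiv.Perm.mul_apply, ih,
      List.map_singleton, List.prod_singleton, one_mul, Equiv.swap_apply_def]
    split_ifs <;> omega

/-- The one-line notation of `w_k^{(i,1)}` is
`[i - k + 1, 1, …, i - k - 1, i - k + 2, …, i, i - k]`. -/
theorem wkij_one_apply {i k : ℕ} (h1 : 1 ≤ k) (h2 : k < i) (x : ℕ) :
    wkij i 1 k x = if x = 1 then i - k + 1 else if x = i then i - k
      else if 2 ≤ x ∧ x ≤ i - k then x - 1 else if i - k < x ∧ x < i then x + 1 else x := by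
  rw [wkij, Equiv.Perm.mul_apply, sasc, sasc_apply, sdesc_one_apply]
  split_ifs <;> omega

theorem wkij_one_supportedUpTo {i k : ℕ} (h1 : 1 ≤ k) (h2 : k < i) :
    SupportedUpTo i (wkij i 1 k) := by
  intro x hx
  simp only [Finset.mem_Icc] at hx
  rw [wkij_one_apply h1 h2]
  split_ifs <;> omega

theorem rightMaxima_wkij_one {n : ℕ} (hn : 2 < n) :
    rightMaxima n (wkij (n - 1) 1 1) = {1, n - 1} := by
  ext p
  simp only [mem_rightMaxima, Finset.mem_insert, Finset.mem_singleton,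
    wkij_one_apply le_rfl (show 1 < n - 1 by omega)]
  constructor
  · rintro ⟨hp, h⟩
    by_contra! hne
    have := h (p + 1) (by omega) (by omega)
    split_ifs at this <;> omega
  · intro hp
    refine ⟨by omega, fun j hj hj' => ?_⟩
    split_ifs <;> omega

theorem rightMaxima_wkij {n k : ℕ} (h1 : 2 ≤ k) (h2 : k ≤ n - 2) :
    rightMaxima n (wkij (n - 1) 1 k) = {n - 2, n - 1} := by
  ext p
  simp only [mem_rightMaxima, Finset.mem_insert, Finset.mem_singleton,
    wkij_one_apply (show 1 ≤ k by omega) (show k < n - 1 by omega)]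
  constructor
  · rintro ⟨hp, h⟩
    by_contra! hne
    have := h (n - 2) (by omega) (by omega)
    split_ifs at this <;> omega
  · intro hp
    refine ⟨by omega, fun j hj hj' => ?_⟩
    split_ifs <;> omega

/-- Case (iii) in the proof of Proposition 3.2.  For `n > 2`, in
`ℤ[x_1, …, x_n]`:
`𝔖_{s_{n-1}} · 𝔖_{w_1^{(n-1,1)}} = 𝔖_{w_1^{(n-1,1)} t_{1,n}} + 𝔖_{w_1^{(n-1,1)} t_{n-1,n}}`,
and for `2 ≤ k ≤ n-2`,
`𝔖_{s_{n-1}} · 𝔖_{w_k^{(n-1,1)}} = 𝔖_{w_k^{(n-1,1)} t_{n-2,n}} + 𝔖_{w_k^{(n-1,1)} t_{n-1,n}}`.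
The Schubert polynomials are encoded as any family `S` satisfying their defining
properties (`hS0`, `hSrec`). -/
theorem stmt8 (n : ℕ) (hn : 2 < n)
    (S : Equiv.Perm ℕ → MvPolynomial ℕ ℤ)
    (hS0 : S (revPerm n) = ∏ r ∈ Finset.Icc 1 (n - 1), X r ^ (n - r))
    (hSrec : ∀ w : Equiv.Perm ℕ, (∀ x, x ∉ Finset.Icc 1 n → w x = x) →
      ∀ r, 1 ≤ r → r < n → w (r + 1) < w r →
        S w - rename (⇑(Equiv.swap r (r + 1))) (S w)
          = (X r - X (r + 1)) * S (w * Equiv.swap r (r + 1))) :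
    S (Equiv.swap (n - 1) n) * S (wkij (n - 1) 1 1)
        = S (wkij (n - 1) 1 1 * Equiv.swap 1 n)
          + S (wkij (n - 1) 1 1 * Equiv.swap (n - 1) n) ∧
    ∀ k, 2 ≤ k → k ≤ n - 2 →
      S (Equiv.swap (n - 1) n) * S (wkij (n - 1) 1 k)
        = S (wkij (n - 1) 1 k * Equiv.swap (n - 2) n)
          + S (wkij (n - 1) 1 k * Equiv.swap (n - 1) n) := by
  have hS : IsSchubertFamily n S := ⟨hS0, hSrec⟩
  refine ⟨?_, fun k h1 h2 => ?_⟩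
  · rw [hS.monk_last (by omega) (wkij_one_supportedUpTo le_rfl (by omega)),
      rightMaxima_wkij_one hn, Finset.sum_pair (by omega)]
  · rw [hS.monk_last (by omega) (wkij_one_supportedUpTo (by omega) (by omega)),
      rightMaxima_wkij h1 h2, Finset.sum_pair (by omega)]
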